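/- For 0 < q < p ≤ 1, n ∈ ℕ, and x ∈ [0,1], the second central moment of the (p,q)-Bernstein-Durrmeyer operator satisfies D_n^{p,q}((t-x)², x) ≤ (6/[n+2]_{p,q}) · (x(1-x) + 1/[n+2]_{p,q}). -/

import Mathlib

noncomputable section

/-- The (p,q)-number [n]_{p,q} = (p^n - q^n)/(p - q). -/
def pqNum (p q : ℝ) (n : ℕ) : ℝ := (p ^ n - q ^ n) / (p - q)

/-- The (p,q)-factorial [n]_{p,q}!. -/
def pqFactorial (p q : ℝ) (n : ℕ) : ℝ := ∏ k ∈ Finset.range n, pqNum p q (k + 1)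

/-- The (p,q)-binomial coefficient. -/
def pqBinom (p q : ℝ) (n k : ℕ) : ℝ :=
  pqFactorial p q n / (pqFactorial p q (n - k) * pqFactorial p q k)

/-- The (p,q)-power basis (a ⊖ b)^n_{p,q} = ∏_{j=0}^{n-1} (p^j a - q^j b). -/
def pqPow (p q a b : ℝ) (n : ℕ) : ℝ := ∏ j ∈ Finset.range n, (p ^ j * a - q ^ j * b)

/-- The (p,q)-derivative. -/
def pqDeriv (p q : ℝ) (f : ℝ → ℝ) (x : ℝ) : ℝ := (f (p * x) - f (q * x)) / ((p - q) * x)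

/-- The (p,q)-integral of f over [0,1] (case 0 < q < p). -/
def pqInt (p q : ℝ) (f : ℝ → ℝ) : ℝ :=
  (p - q) * ∑' k : ℕ, (q ^ k / p ^ (k + 1)) * f (q ^ k / p ^ (k + 1))

/-- The (p,q)-Beta function B_{p,q}(m,n) = ∫₀¹ x^{m-1} (1 ⊖ qx)^{n-1} d_{p,q}x. -/
def pqBeta (p q : ℝ) (m n : ℕ) : ℝ :=
  pqInt p q (fun x => x ^ (m - 1) * pqPow p q 1 (q * x) (n - 1))

/-- The (p,q)-Gamma function: Γ_{p,q}(n+1) = [n]_{p,q}!. -/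
def pqGamma (p q : ℝ) (n : ℕ) : ℝ := pqFactorial p q (n - 1)

/-- The (p,q)-Bernstein basis b_{n,k}^{p,q}(1,x). -/
def bBasis (p q : ℝ) (n k : ℕ) (x : ℝ) : ℝ :=
  pqBinom p q n k * p ^ (k * (k - 1) / 2) / p ^ (n * (n - 1) / 2) * x ^ k *
    pqPow p q 1 x (n - k)

/-- The kernel b_{n,k}^{p,q}(t) = [n choose k] t^k (1 ⊖ qt)^{n-k}. -/
def bKernel (p q : ℝ) (n k : ℕ) (t : ℝ) : ℝ :=
  pqBinom p q n k * t ^ k * pqPow p q 1 (q * t) (n - k)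

/-- The (p,q)-Bernstein operator B_{n,p,q}(f,x). -/
def pqBernstein (p q : ℝ) (n : ℕ) (f : ℝ → ℝ) (x : ℝ) : ℝ :=
  ∑ k ∈ Finset.range (n + 1),
    bBasis p q n k x * f (p ^ (n - k) * pqNum p q k / pqNum p q n)

/-- The (p,q)-Bernstein-Durrmeyer operator D_n^{p,q}(f,x). -/
def pqDurrmeyer (p q : ℝ) (n : ℕ) (f : ℝ → ℝ) (x : ℝ) : ℝ :=
  pqNum p q (n + 1) *
    ∑ k ∈ Finset.Icc 1 n, (p ^ ((n - k + 1) * (n + k) / 2))⁻¹ * bBasis p q n k x *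
      pqInt p q (fun t => bKernel p q n (k - 1) t * f t)
  + bBasis p q n 0 x * f 0

theorem pqNum_zero (p q : ℝ) : pqNum p q 0 = 0 := by simp [pqNum]

theorem pqNum_add {p q : ℝ} (hqp : q < p) (a b : ℕ) :
    pqNum p q (a + b) = p ^ a * pqNum p q b + q ^ b * pqNum p q a := by
  have h : p - q ≠ 0 := (sub_pos.2 hqp).ne'
  unfold pqNum
  field_simp
  ring

theorem pqNum_one {p q : ℝ} (hqp : q < p) : pqNum p q 1 = 1 := by
  have h : p - q ≠ 0 := (sub_pos.2 hqp).ne'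
  simp [pqNum, h]

theorem pqNum_two {p q : ℝ} (hqp : q < p) : pqNum p q 2 = p + q := by
  rw [pqNum_add hqp 1 1, pqNum_one hqp]
  ring

theorem pqNum_three {p q : ℝ} (hqp : q < p) : pqNum p q 3 = p ^ 2 + p * q + q ^ 2 := by
  rw [pqNum_add hqp 2 1, pqNum_one hqp, pqNum_two hqp]
  ring

theorem pqNum_pos {p q : ℝ} (hq : 0 < q) (hqp : q < p) (n : ℕ) : 0 < pqNum p q (n + 1) :=
  div_pos (sub_pos.2 (pow_lt_pow_left₀ hqp hq.le n.succ_ne_zero)) (sub_pos.2 hqp)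

theorem pqNum_nonneg {p q : ℝ} (hq : 0 < q) (hqp : q < p) (n : ℕ) : 0 ≤ pqNum p q n := by
  cases n with
  | zero => rw [pqNum_zero]
  | succ n => exact (pqNum_pos hq hqp n).le

theorem one_sub_mul_pqNum_le {p q : ℝ} (hq : 0 < q) (hqp : q < p) (hp : p ≤ 1) (n : ℕ) :
    (1 - p) * pqNum p q n ≤ 1 - p ^ n := by
  induction n with
  | zero => simp [pqNum_zero]
  | succ n ih =>
    rw [pqNum_add hqp n 1, pqNum_one hqp, pow_succ p n]
    have h : 0 ≤ (1 - p) * pqNum p q n :=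
      mul_nonneg (sub_nonneg.2 hp) (pqNum_nonneg hq hqp n)
    nlinarith [mul_nonneg (sub_nonneg.2 (hqp.le.trans hp)) h]

theorem pqFactorial_succ (p q : ℝ) (n : ℕ) :
    pqFactorial p q (n + 1) = pqFactorial p q n * pqNum p q (n + 1) :=
  Finset.prod_range_succ _ _

theorem pqFactorial_pos {p q : ℝ} (hq : 0 < q) (hqp : q < p) (n : ℕ) : 0 < pqFactorial p q n :=
  Finset.prod_pos fun k _ => pqNum_pos hq hqp k

theorem pqPow_succ (p q a b : ℝ) (n : ℕ) :
    pqPow p q a b (n + 1) = pqPow p q a b n * (p ^ n * a - q ^ n * b) :=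
  Finset.prod_range_succ _ _

/-- The (p,q)-Beta integral, with summability of the defining series. -/
theorem hasSum_pow_mul_pqPow {p q : ℝ} (hq : 0 < q) (hqp : q < p) (m a : ℕ) :
    HasSum (fun k : ℕ => (p - q) * ((q ^ k / p ^ (k + 1)) *
        ((q ^ k / p ^ (k + 1)) ^ a * pqPow p q 1 (q * (q ^ k / p ^ (k + 1))) m)))
      (p ^ (a * m + (m + 1) * m / 2) * pqFactorial p q a * pqFactorial p q m /
        pqFactorial p q (a + m + 1)) := by
  have hp : 0 < p := hq.trans hqp
  induction m generalizing a with
  | zero =>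
    have hr : (q / p) ^ (a + 1) < 1 :=
      pow_lt_one₀ (by positivity) ((div_lt_one hp).2 hqp) a.succ_ne_zero
    have h := (hasSum_geometric_of_lt_one (by positivity) hr).mul_left ((p - q) / p ^ (a + 1))
    have hden : p ^ (a + 1) - q ^ (a + 1) ≠ 0 :=
      (sub_pos.2 (pow_lt_pow_left₀ hqp hq.le a.succ_ne_zero)).ne'
    have hF := (pqFactorial_pos hq hqp a).ne'
    have h1 : 1 - (q / p) ^ (a + 1) = (p ^ (a + 1) - q ^ (a + 1)) / p ^ (a + 1) := by
      rw [div_pow]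
      field_simp
    have hval : p ^ (a * 0 + (0 + 1) * 0 / 2) * pqFactorial p q a * pqFactorial p q 0 /
        pqFactorial p q (a + 0 + 1) = (p - q) / p ^ (a + 1) * (1 - (q / p) ^ (a + 1))⁻¹ := by
      rw [h1, add_zero, pqFactorial_succ, pqNum]
      simp only [pqFactorial, Finset.range_zero, Finset.prod_empty] at hF ⊢
      field_simp
      simp
    rw [hval]
    refine (congrArg (HasSum · _) (funext fun k => ?_)).mp h
    simp only [pqPow, Finset.range_zero, Finset.prod_empty, mul_one, div_pow, ← pow_mul]
    field_simp
    ring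
  | succ m ih =>
    have h := ((ih a).mul_left (p ^ m)).sub ((ih (a + 1)).mul_left (q ^ (m + 1)))
    have hF := (pqFactorial_pos hq hqp (a + m + 1)).ne'
    have hN := (pqNum_pos hq hqp (a + m + 1)).ne'
    have ht := Nat.triangle_succ (m + 1)
    rw [Nat.add_sub_cancel, Nat.add_sub_cancel] at ht
    have hval : p ^ (a * (m + 1) + (m + 1 + 1) * (m + 1) / 2) * pqFactorial p q a *
        pqFactorial p q (m + 1) / pqFactorial p q (a + (m + 1) + 1) =
        p ^ m * (p ^ (a * m + (m + 1) * m / 2) * pqFactorial p q a * pqFactorial p q m /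
          pqFactorial p q (a + m + 1)) -
        q ^ (m + 1) * (p ^ ((a + 1) * m + (m + 1) * m / 2) * pqFactorial p q (a + 1) *
          pqFactorial p q m / pqFactorial p q (a + 1 + m + 1)) := by
      rw [ht, show a + (m + 1) + 1 = a + m + 1 + 1 by ring,
        show a + 1 + m + 1 = a + m + 1 + 1 by ring, pqFactorial_succ p q (a + m + 1),
        pqFactorial_succ p q a, pqFactorial_succ p q m]
      field_simp
      rw [show a + m + 1 + 1 = (a + 1) + (m + 1) by ring, pqNum_add hqp (a + 1) (m + 1)]
      ring
    rw [hval]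
    refine (congrArg (HasSum · _) (funext fun k => ?_)).mp h
    rw [pqPow_succ]
    ring

theorem bBasis_succ_left {p q : ℝ} (hq : 0 < q) (hqp : q < p) (k m : ℕ) (x : ℝ) :
    pqNum p q (m + 1) * p ^ m * bBasis p q (k + m + 1) k x * p ^ k =
      pqNum p q (k + m + 1) * (p ^ m - q ^ m * x) * bBasis p q (k + m) k x := by
  have hp : 0 < p := hq.trans hqp
  have h1 := (pqFactorial_pos hq hqp m).ne'
  have h2 := (pqFactorial_pos hq hqp k).ne'
  have h3 := (pqNum_pos hq hqp m).ne'
  unfold bBasis pqBinom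
  rw [Nat.triangle_succ (k + m), show k + m + 1 - k = m + 1 by omega, Nat.add_sub_cancel_left,
    pqFactorial_succ, pqFactorial_succ, pqPow_succ]
  field_simp
  ring

theorem bBasis_succ_succ {p q : ℝ} (hq : 0 < q) (hqp : q < p) (k m : ℕ) (x : ℝ) :
    p ^ m * pqNum p q (k + 1) * bBasis p q (k + m + 1) (k + 1) x =
      pqNum p q (k + m + 1) * x * bBasis p q (k + m) k x := by
  have hp : 0 < p := hq.trans hqp
  have h1 := (pqFactorial_pos hq hqp m).ne'
  have h2 := (pqFactorial_pos hq hqp k).ne'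
  have h3 := (pqNum_pos hq hqp k).ne'
  unfold bBasis pqBinom
  rw [Nat.triangle_succ (k + m), Nat.triangle_succ k, show k + m + 1 - (k + 1) = m by omega,
    Nat.add_sub_cancel_left, pqFactorial_succ, pqFactorial_succ]
  field_simp
  ring

theorem sum_bBasis {p q : ℝ} (hq : 0 < q) (hqp : q < p) (n : ℕ) (x : ℝ) :
    ∑ k ∈ Finset.range (n + 1), bBasis p q n k x = 1 := by
  have hp : 0 < p := hq.trans hqp
  induction n with
  | zero => simp [bBasis, pqBinom, pqFactorial, pqPow]
  | succ n ih =>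
    have hN := (pqNum_pos hq hqp n).ne'
    refine mul_left_cancel₀ hN ?_
    have hsplit : ∀ k ∈ Finset.range (n + 1 + 1),
        pqNum p q (n + 1) * bBasis p q (n + 1) k x =
          p ^ k * pqNum p q (n + 1 - k) * bBasis p q (n + 1) k x +
            q ^ (n + 1 - k) * pqNum p q k * bBasis p q (n + 1) k x := by
      intro k hk
      have hk : k ≤ n + 1 := Nat.lt_succ_iff.1 (Finset.mem_range.1 hk)
      conv_lhs => rw [show n + 1 = k + (n + 1 - k) by omega, pqNum_add hqp]
      rw [show k + (n + 1 - k) = n + 1 by omega]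
      ring
    rw [Finset.mul_sum, Finset.sum_congr rfl hsplit, Finset.sum_add_distrib,
      Finset.sum_range_succ, Finset.sum_range_succ' (fun k => q ^ (n + 1 - k) * _ * _),
      Nat.sub_self, pqNum_zero, mul_zero, zero_mul, add_zero, mul_zero, zero_mul, add_zero,
      ← Finset.sum_add_distrib, ← ih, Finset.mul_sum]
    refine Finset.sum_congr rfl fun k hk => ?_
    obtain ⟨m, rfl⟩ := Nat.exists_eq_add_of_le (Nat.lt_succ_iff.1 (Finset.mem_range.1 hk))
    rw [show k + m + 1 - k = m + 1 by omega, show k + m + 1 - (k + 1) = m by omega]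
    refine mul_left_cancel₀ (pow_pos hp m).ne' ?_
    linear_combination bBasis_succ_left hq hqp k m x + q ^ m * bBasis_succ_succ hq hqp k m x

theorem sum_pqNum_mul_bBasis {p q : ℝ} (hq : 0 < q) (hqp : q < p) (n : ℕ) (x : ℝ) (g : ℕ → ℝ) :
    ∑ k ∈ Finset.range (n + 2), p ^ (n + 1 - k) * pqNum p q k * bBasis p q (n + 1) k x * g k =
      pqNum p q (n + 1) * x * ∑ k ∈ Finset.range (n + 1), bBasis p q n k x * g (k + 1) := by
  rw [Finset.sum_range_succ', pqNum_zero, mul_zero, zero_mul, zero_mul, add_zero, Finset.mul_sum]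
  refine Finset.sum_congr rfl fun k hk => ?_
  obtain ⟨m, rfl⟩ := Nat.exists_eq_add_of_le (Nat.lt_succ_iff.1 (Finset.mem_range.1 hk))
  rw [show k + m + 1 - (k + 1) = m by omega]
  linear_combination g (k + 1) * bBasis_succ_succ hq hqp k m x

theorem sum_bBasis_mul_pqNum {p q : ℝ} (hq : 0 < q) (hqp : q < p) (n : ℕ) (x : ℝ) :
    ∑ k ∈ Finset.range (n + 1), bBasis p q n k x * (p ^ (n - k) * pqNum p q k) =
      pqNum p q n * x := by
  cases n with
  | zero => simp [pqNum_zero]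
  | succ n =>
    have h := sum_pqNum_mul_bBasis hq hqp n x fun _ => 1
    simp only [mul_one, sum_bBasis hq hqp] at h
    rw [← h]
    exact Finset.sum_congr rfl fun k _ => by ring

theorem sum_bBasis_mul_pqNum_mul_pqNum {p q : ℝ} (hq : 0 < q) (hqp : q < p) (n : ℕ) (x : ℝ) :
    ∑ k ∈ Finset.range (n + 1),
        bBasis p q n k x * (p ^ (2 * (n - k + 1)) * (pqNum p q k * pqNum p q (k + 1))) =
      p * (p + q) * p ^ n * pqNum p q n * x +
        q * pqNum p q n * (p ^ 2 * pqNum p q n - p * p ^ n) * x ^ 2 := by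
  cases n with
  | zero => simp [pqNum_zero]
  | succ n =>
    have hterm : ∀ k ∈ Finset.range (n + 1 + 1), bBasis p q (n + 1) k x *
        (p ^ (2 * (n + 1 - k + 1)) * (pqNum p q k * pqNum p q (k + 1))) =
        p ^ (n + 1 - k) * pqNum p q k * bBasis p q (n + 1) k x *
          (p ^ 2 * (p ^ (n + 1 - k) * pqNum p q (k + 1))) := by
      intro k _
      rw [mul_add, pow_add, mul_comm 2, pow_mul]
      ring
    rw [Finset.sum_congr rfl hterm, sum_pqNum_mul_bBasis hq hqp n x
      fun k => p ^ 2 * (p ^ (n + 1 - k) * pqNum p q (k + 1))]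
    have hterm' : ∀ k ∈ Finset.range (n + 1), bBasis p q n k x *
        (p ^ 2 * (p ^ (n + 1 - (k + 1)) * pqNum p q (k + 1 + 1))) =
        p ^ 2 * (p + q) * p ^ n * bBasis p q n k x +
          p ^ 2 * q ^ 2 * (bBasis p q n k x * (p ^ (n - k) * pqNum p q k)) := by
      intro k hk
      obtain ⟨m, rfl⟩ := Nat.exists_eq_add_of_le (Nat.lt_succ_iff.1 (Finset.mem_range.1 hk))
      rw [show k + m + 1 - (k + 1) = m by omega, Nat.add_sub_cancel_left, add_assoc k 1 1,
        pqNum_add hqp, pqNum_two hqp]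
      ring
    rw [Finset.sum_congr rfl hterm', Finset.sum_add_distrib, ← Finset.mul_sum, ← Finset.mul_sum,
      sum_bBasis hq hqp, sum_bBasis_mul_pqNum hq hqp, pqNum_add hqp n 1, pqNum_one hqp]
    ring

theorem pqInt_bKernel_mul_sq {p q : ℝ} (hq : 0 < q) (hqp : q < p) (j l : ℕ) (x : ℝ) :
    pqNum p q (j + l + 2) * (p ^ ((l + 1) * (j + 1 + l + (j + 1)) / 2))⁻¹ *
        pqInt p q (fun t => bKernel p q (j + 1 + l) j t * (t - x) ^ 2) =
      x ^ 2 - 2 * x * (p ^ (l + 1) * pqNum p q (j + 1)) / pqNum p q (j + l + 3) +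
        p ^ (2 * (l + 1)) * (pqNum p q (j + 1) * pqNum p q (j + 2)) /
          (pqNum p q (j + l + 3) * pqNum p q (j + l + 4)) := by
  have hp : 0 < p := hq.trans hqp
  have hs := (((hasSum_pow_mul_pqPow hq hqp (l + 1) (j + 2)).sub
    ((hasSum_pow_mul_pqPow hq hqp (l + 1) (j + 1)).mul_left (2 * x))).add
    ((hasSum_pow_mul_pqPow hq hqp (l + 1) j).mul_left (x ^ 2))).mul_left
      (pqBinom p q (j + 1 + l) j)
  have hint := hs.tsum_eq
  rw [show (∑' k, _) = pqInt p q (fun t => bKernel p q (j + 1 + l) j t * (t - x) ^ 2) by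
    rw [pqInt, ← tsum_mul_left]
    refine tsum_congr fun k => ?_
    rw [bKernel, show j + 1 + l - j = l + 1 by omega]
    ring] at hint
  have he : (l + 1) * (j + 1 + l + (j + 1)) / 2 = j * (l + 1) + (l + 1 + 1) * (l + 1) / 2 := by
    rw [show (l + 1) * (j + 1 + l + (j + 1)) = (l + 1 + 1) * (l + 1) + 2 * (j * (l + 1)) by ring,
      Nat.add_mul_div_left _ _ two_pos, add_comm]
  have hF := (pqFactorial_pos hq hqp (j + l + 1)).ne'
  have hj := (pqFactorial_pos hq hqp j).ne'
  have hl := (pqFactorial_pos hq hqp (l + 1)).ne'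
  have h2 := (pqNum_pos hq hqp (j + l + 1)).ne'
  have h3 := (pqNum_pos hq hqp (j + l + 2)).ne'
  have h4 := (pqNum_pos hq hqp (j + l + 3)).ne'
  rw [hint, he, pqBinom, show j + 1 + l - j = l + 1 by omega,
    show j + 2 + (l + 1) + 1 = j + l + 1 + 1 + 1 + 1 by ring,
    show j + 1 + (l + 1) + 1 = j + l + 1 + 1 + 1 by ring,
    show j + (l + 1) + 1 = j + l + 1 + 1 by ring,
    show j + 1 + l = j + l + 1 by ring, pqFactorial_succ p q (j + l + 1 + 1 + 1),
    pqFactorial_succ p q (j + l + 1 + 1), pqFactorial_succ p q (j + l + 1),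
    pqFactorial_succ p q (j + 1), pqFactorial_succ p q j]
  generalize (l + 1 + 1) * (l + 1) / 2 = e
  simp only [add_assoc, Nat.reduceAdd] at *
  field_simp
  ring

theorem pqDurrmeyer_central_moment {p q : ℝ} (hq : 0 < q) (hqp : q < p) (n : ℕ) (x : ℝ) :
    pqDurrmeyer p q n (fun t => (t - x) ^ 2) x =
      x ^ 2 - 2 * x * (p * (pqNum p q n * x)) / pqNum p q (n + 2) +
        (p * (p + q) * p ^ n * pqNum p q n * x +
          q * pqNum p q n * (p ^ 2 * pqNum p q n - p * p ^ n) * x ^ 2) /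
          (pqNum p q (n + 2) * pqNum p q (n + 3)) := by
  have hsum : pqDurrmeyer p q n (fun t => (t - x) ^ 2) x =
      ∑ k ∈ Finset.range (n + 1), bBasis p q n k x *
        (x ^ 2 - 2 * x * (p ^ (n - k + 1) * pqNum p q k) / pqNum p q (n + 2) +
          p ^ (2 * (n - k + 1)) * (pqNum p q k * pqNum p q (k + 1)) /
            (pqNum p q (n + 2) * pqNum p q (n + 3))) := by
    rw [pqDurrmeyer, Finset.sum_range_succ', pqNum_zero, Finset.mul_sum]
    congr 1
    · rw [← Finset.Ico_add_one_right_eq_Icc, Finset.sum_Ico_eq_sum_range, Nat.add_sub_cancel]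
      refine Finset.sum_congr rfl fun j hj => ?_
      obtain ⟨l, rfl⟩ := Nat.exists_eq_add_of_le (Nat.succ_le_of_lt (Finset.mem_range.1 hj))
      have h := pqInt_bKernel_mul_sq hq hqp j l x
      simp only [Nat.succ_eq_add_one, add_comm 1 j, Nat.add_sub_cancel, Nat.add_sub_cancel_left]
      rw [show j + 1 + l + 1 = j + l + 2 by ring, show j + 1 + l + 2 = j + l + 3 by ring,
        show j + 1 + l + 3 = j + l + 4 by ring]
      linear_combination bBasis p q (j + 1 + l) (j + 1) x * h
    · ring
  have hlin : x ^ 2 - 2 * x * (p * (pqNum p q n * x)) / pqNum p q (n + 2) =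
      x ^ 2 * 1 - 2 * x * p / pqNum p q (n + 2) * (pqNum p q n * x) := by ring
  rw [hsum, hlin, ← sum_bBasis_mul_pqNum_mul_pqNum hq hqp n x, ← sum_bBasis_mul_pqNum hq hqp n x,
    ← sum_bBasis hq hqp n x, Finset.mul_sum, Finset.mul_sum, Finset.sum_div,
    ← Finset.sum_sub_distrib, ← Finset.sum_add_distrib]
  refine Finset.sum_congr rfl fun k _ => ?_
  ring

/-- The value of the central moment at `x = 1`, after clearing denominators, in terms of
`a = [n]` and `Q = q ^ n`; the factors are `[n + 2]` and `[n + 3]`. -/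
theorem central_moment_at_one_bound {p q a Q : ℝ} (hq : 0 < q) (hqp : q < p) (hp : p ≤ 1)
    (ha : 0 ≤ a) (hQ : 0 ≤ Q) (hv : (p - q) * a ≤ 1 - Q) (hu : (1 - p) * a ≤ 1 - Q) :
    (p ^ 2 * a + (p + q) * Q) *
      (p ^ 3 * (1 - p) ^ 2 * a ^ 2 +
        a * Q * (p ^ 2 - 2 * p * (p ^ 2 + p * q + q ^ 2) + p ^ 2 * (p ^ 2 + p * q + q ^ 2) +
          (p + q) * p ^ 3) + (p + q) * (p ^ 2 + p * q + q ^ 2) * Q ^ 2) ≤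
      6 * (p ^ 3 * a + (p ^ 2 + p * q + q ^ 2) * Q) := by
  have hp0 : 0 < p := hq.trans hqp
  have hd : 0 < p - q := sub_pos.2 hqp
  have hp1 : 0 ≤ 1 - p := sub_nonneg.2 hp
  have hQ1 : Q ≤ 1 := by nlinarith [mul_nonneg hd.le ha]
  set s := p + q with hs
  set c := p ^ 2 + p * q + q ^ 2 with hc
  set u := (1 - p) * a with hu'
  set v := (p - q) * a with hv'
  have hs0 : 0 < s := by positivity
  have hc0 : 0 < c := by positivity
  have hu0 : 0 ≤ u := mul_nonneg hp1 ha
  have hv0 : 0 ≤ v := mul_nonneg hd.le ha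
  have hs2 : s ≤ 2 * p := by linarith
  have hps : p * s ≤ 2 := by nlinarith
  have hss : s ^ 2 ≤ 6 := by nlinarith
  have hspc : s * p ≤ c := by nlinarith [sq_nonneg q]
  have hc3 : c ≤ 3 * p ^ 2 := by nlinarith
  have hsc : s * c ≤ 6 * p ^ 3 := by
    calc s * c ≤ (2 * p) * (3 * p ^ 2) := mul_le_mul hs2 hc3 hc0.le (by positivity)
      _ = 6 * p ^ 3 := by ring
  set W := p ^ 2 * u ^ 2 + p * (1 - p) * u * Q + p * s * v * Q with hW
  have hW0 : 0 ≤ W := by positivity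
  have hW6 : W + 6 * Q ^ 2 ≤ 6 := by
    have h1 : p ^ 2 * u ^ 2 ≤ 1 * (1 - Q) ^ 2 := by gcongr; exact pow_le_one₀ hp0.le hp
    have h2 : p * (1 - p) * u * Q ≤ 1 * (1 - Q) * Q := by gcongr; nlinarith
    have h3 : p * s * v * Q ≤ 2 * (1 - Q) * Q := by gcongr
    nlinarith
  have hmid : p ^ 2 - 2 * p * c + p ^ 2 * c + s * p ^ 3 ≤
      p ^ 2 * (1 - p) ^ 2 + p ^ 2 * (p - q) * s := by
    have h1 : 0 ≤ p ^ 2 * q * (1 - p) := by positivity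
    have h2 : 0 ≤ p * q ^ 2 * (1 - p) := by positivity
    rw [hc, hs]
    nlinarith
  have hE : p ^ 3 * (1 - p) ^ 2 * a ^ 2 + a * Q * (p ^ 2 - 2 * p * c + p ^ 2 * c + s * p ^ 3) +
      s * c * Q ^ 2 ≤ p * W + s * c * Q ^ 2 := by
    have h := mul_le_mul_of_nonneg_left hmid (mul_nonneg ha hQ)
    rw [hW, hu', hv']
    linarith
  calc _ ≤ (p ^ 2 * a + s * Q) * (p * W + s * c * Q ^ 2) := by gcongr
    _ = p ^ 3 * a * W + p ^ 2 * a * Q ^ 2 * (s * c) + (s * p * W + c * Q ^ 2 * s ^ 2) * Q := by ring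
    _ ≤ p ^ 3 * a * W + p ^ 2 * a * Q ^ 2 * (6 * p ^ 3) + (c * W + c * Q ^ 2 * 6) * Q := by gcongr
    _ = p ^ 3 * a * (W + p ^ 2 * (6 * Q ^ 2)) + c * Q * (W + 6 * Q ^ 2) := by ring
    _ ≤ p ^ 3 * a * (W + 1 * (6 * Q ^ 2)) + c * Q * (W + 6 * Q ^ 2) := by
      gcongr
      exact pow_le_one₀ hp0.le hp
    _ = (p ^ 3 * a + c * Q) * (W + 6 * Q ^ 2) := by ring
    _ ≤ (p ^ 3 * a + c * Q) * 6 := by gcongr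
    _ = _ := by ring

theorem pqDurrmeyer_central_moment_bound (p q : ℝ) (hq : 0 < q) (hqp : q < p) (hp : p ≤ 1)
    (n : ℕ) (x : ℝ) (hx : x ∈ Set.Icc (0 : ℝ) 1) :
    pqDurrmeyer p q n (fun t => (t - x) ^ 2) x ≤
      6 / pqNum p q (n + 2) * (x * (1 - x) + 1 / pqNum p q (n + 2)) := by
  obtain ⟨hx0, hx1⟩ := hx
  have hp0 : 0 < p := hq.trans hqp
  have ha := pqNum_nonneg hq hqp n
  have hQ : 0 < q ^ n := pow_pos hq n
  have hPQ : (p - q) * pqNum p q n = p ^ n - q ^ n :=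
    mul_div_cancel₀ _ (sub_pos.2 hqp).ne'
  have hN := pqNum_pos hq hqp (n + 1)
  have hM := pqNum_pos hq hqp (n + 2)
  have hNeq : pqNum p q (n + 2) = p ^ 2 * pqNum p q n + (p + q) * q ^ n := by
    rw [add_comm n 2, pqNum_add hqp, pqNum_two hqp]
    ring
  have hMeq : pqNum p q (n + 3) = p ^ 3 * pqNum p q n + (p ^ 2 + p * q + q ^ 2) * q ^ n := by
    rw [add_comm n 3, pqNum_add hqp, pqNum_three hqp]
    ring
  have hQP : q ^ n ≤ p ^ n := pow_le_pow_left₀ hq.le hqp.le n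
  have hP1 : p ^ n ≤ 1 := pow_le_one₀ hp0.le hp
  have hlin : p * (p + q) * p ^ n * pqNum p q n ≤ 6 * pqNum p q (n + 3) := by
    rcases n.eq_zero_or_pos with rfl | hn
    · rw [pqNum_zero, mul_zero]
      exact mul_nonneg (by norm_num) hM.le
    · have hPp : p ^ n ≤ p := pow_le_of_le_one hp0.le hp hn.ne'
      calc p * (p + q) * p ^ n * pqNum p q n ≤ p * (p + p) * p * pqNum p q n := by gcongr
        _ = 2 * (p ^ 3 * pqNum p q n) := by ring
        _ ≤ 6 * pqNum p q (n + 3) := by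
          rw [hMeq]
          have h1 : 0 ≤ p ^ 3 * pqNum p q n := by positivity
          have h2 : 0 ≤ (p ^ 2 + p * q + q ^ 2) * q ^ n := by positivity
          linarith
  have hone := central_moment_at_one_bound hq hqp hp ha hQ.le (by linarith)
    ((one_sub_mul_pqNum_le hq hqp hp n).trans (by linarith))
  rw [pqDurrmeyer_central_moment hq hqp]
  have hP : p ^ n = q ^ n + (p - q) * pqNum p q n := by linarith
  rw [← hNeq, ← hMeq] at hone
  have hG : p ^ 3 * (1 - p) ^ 2 * pqNum p q n ^ 2 +
      pqNum p q n * q ^ n * (p ^ 2 - 2 * p * (p ^ 2 + p * q + q ^ 2) +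
        p ^ 2 * (p ^ 2 + p * q + q ^ 2) + (p + q) * p ^ 3) +
      (p + q) * (p ^ 2 + p * q + q ^ 2) * (q ^ n) ^ 2 =
      pqNum p q (n + 2) * pqNum p q (n + 3) - 2 * p * pqNum p q n * pqNum p q (n + 3) +
        p * (p + q) * p ^ n * pqNum p q n +
        q * pqNum p q n * (p ^ 2 * pqNum p q n - p * p ^ n) := by
    rw [hP, hNeq, hMeq]
    ring
  rw [hG] at hone
  generalize pqNum p q n = a at *
  generalize pqNum p q (n + 2) = N at *
  generalize pqNum p q (n + 3) = M at *
  generalize p ^ n = P at *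
  have hxx : 0 ≤ x * (1 - x) := mul_nonneg hx0 (sub_nonneg.2 hx1)
  have h1 := mul_le_mul_of_nonneg_left hlin (mul_nonneg hxx hN.le)
  have h2 := mul_le_mul_of_nonneg_left hone (sq_nonneg x)
  have h3 : x ^ 2 * (6 * M) ≤ 1 * (6 * M) := by
    gcongr
    exact pow_le_one₀ hx0 hx1
  rw [← sub_nonneg]
  have hdiff : 6 / N * (x * (1 - x) + 1 / N) -
      (x ^ 2 - 2 * x * (p * (a * x)) / N +
        (p * (p + q) * P * a * x + q * a * (p ^ 2 * a - p * P) * x ^ 2) / (N * M)) =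
      (x * (1 - x) * N * (6 * M) - x * (1 - x) * N * (p * (p + q) * P * a) + 6 * M -
        x ^ 2 * (N * (N * M - 2 * p * a * M + p * (p + q) * P * a +
          q * a * (p ^ 2 * a - p * P)))) / (N ^ 2 * M) := by
    field_simp
    ring
  rw [hdiff]
  exact div_nonneg (by linarith) (by positivity)
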